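/- Let X be a nonempty set and n ≥ 3. Every associative operation F : X^n → X that is quasitrivial on D^n_{n-1} is reducible to an associative binary operation, i.e., there exists an associative G : X^2 → X such that F(x_1,…,x_n) = G(x_1, G(x_2, …, G(x_{n-1}, x_n)…)) for all x_1,…,x_n ∈ X. -/

import Mathlib

variable {X : Type*}

/-- The result of substituting `F` applied to the `n` consecutive entries starting at
position `i` of the `(2n-1)`-tuple `x` (given as the first `2n-1` values of `x : ℕ → X`),
and then applying `F` to the resulting `n`-tuple. -/
def naryCompAt (n : ℕ) (F : (Fin n → X) → X) (x : ℕ → X) (i : ℕ) : X :=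
  F fun j => if (j : ℕ) < i then x j
    else if (j : ℕ) = i then F (fun k => x (i + (k : ℕ)))
    else x ((j : ℕ) + n - 1)

/-- `F` is an associative `n`-ary operation. -/
def NAryAssociative (n : ℕ) (F : (Fin n → X) → X) : Prop :=
  ∀ (x : ℕ → X) (i : ℕ), i + 1 ≤ n - 1 → naryCompAt n F x i = naryCompAt n F x (i + 1)

/-- `e` is a neutral element for the `n`-ary operation `F`: inserting the argument `a` at
any position `p`, with `e` at all the other positions, returns `a`. -/
def NAryNeutral (n : ℕ) (F : (Fin n → X) → X) (e : X) : Prop :=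
  ∀ (a : X) (p : Fin n), F (Function.update (fun _ => e) p a) = a

/-- The set `E_F` of neutral elements for `F`. -/
def naryNeutralSet (n : ℕ) (F : (Fin n → X) → X) : Set X :=
  {e | NAryNeutral n F e}

/-- `e` is a neutral element for the restriction of `F` to `S^n`. -/
def NAryNeutralOn (n : ℕ) (F : (Fin n → X) → X) (S : Set X) (e : X) : Prop :=
  e ∈ S ∧ ∀ a ∈ S, ∀ p : Fin n, F (Function.update (fun _ => e) p a) = a

/-- `iterOp G m x = G (x 0) (G (x 1) (⋯ (G (x (m-1)) (x m))⋯))`,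
the `m`-fold iterate of the binary operation `G`, applied to `m+1` arguments. -/
def iterOp (G : X → X → X) : ℕ → (ℕ → X) → X
  | 0, x => x 0
  | m + 1, x => G (x 0) (iterOp G m fun i => x (i + 1))

/-- The `n`-ary operation `F` is reducible to the binary operation `G`, i.e. `F` is the
`(n-1)`-fold iterate of `G`. -/
def NAryReducibleTo (n : ℕ) (F : (Fin n → X) → X) (G : X → X → X) : Prop :=
  ∀ x : ℕ → X, F (fun i : Fin n => x i) = iterOp G (n - 1) x

/-- `gPow G a m` is the `G`-product of `m + 1` copies of `a`. -/
def gPow (G : X → X → X) (a : X) : ℕ → X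
  | 0 => a
  | m + 1 => G a (gPow G a m)

/-- `(Y, G)` is an Abelian group whose exponent divides `m` (for `m ≥ 1`): `G` maps `Y × Y`
into `Y` and is commutative and associative on `Y`, and `Y` contains a neutral element `e`
for which every element of `Y` has an inverse and such that the `G`-product of `m` copies of
any element of `Y` equals `e`. -/
def IsAbelianGroupOfExpDvdOn (Y : Set X) (G : X → X → X) (m : ℕ) : Prop :=
  (∀ a ∈ Y, ∀ b ∈ Y, G a b ∈ Y) ∧
  (∀ a ∈ Y, ∀ b ∈ Y, G a b = G b a) ∧
  (∀ a ∈ Y, ∀ b ∈ Y, ∀ c ∈ Y, G (G a b) c = G a (G b c)) ∧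
  ∃ e ∈ Y, (∀ a ∈ Y, G e a = a) ∧ (∀ a ∈ Y, ∃ b ∈ Y, G a b = e) ∧
    (∀ a ∈ Y, gPow G a (m - 1) = e)

/-- The tuple `x` lies in `D^n_k`: at least `k` of its components are equal to each other. -/
def MemD (n k : ℕ) (x : Fin n → X) : Prop :=
  ∃ S : Finset (Fin n), k ≤ S.card ∧ ∀ i ∈ S, ∀ j ∈ S, x i = x j

/-- `F` is quasitrivial on `D^n_k`. -/
def NAryQuasitrivialOnD (n k : ℕ) (F : (Fin n → X) → X) : Prop :=
  ∀ x : Fin n → X, MemD n k x → F x ∈ Set.range x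

/-- `F` is quasitrivial on `S^n_k`, the set of tuples taking at most `k` distinct values. -/
def NAryQuasitrivialOnS (n k : ℕ) (F : (Fin n → X) → X) : Prop :=
  ∀ x : Fin n → X, (Set.range x).encard ≤ k → F x ∈ Set.range x

/-- `F` is quasitrivial. -/
def NAryQuasitrivial (n : ℕ) (F : (Fin n → X) → X) : Prop :=
  ∀ x : Fin n → X, F x ∈ Set.range x

/-- The value of the `n`-ary operation `F` on the first `n` entries of a list, padded with `d`. -/
def naryOnList (n : ℕ) (F : (Fin n → X) → X) (d : X) (l : List X) : X :=
  F fun i => l.getD i d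

/-- Repeatedly replace the first `n` entries of a list by their value under `F`. -/
def naryReduce (n : ℕ) (hn : 2 ≤ n) (F : (Fin n → X) → X) (d : X) (l : List X) : List X :=
  if n ≤ l.length then naryReduce n hn F d (naryOnList n F d l :: l.drop n) else l
termination_by l.length
decreasing_by simp; omega

theorem naryReduce_of_length_lt {n : ℕ} (hn : 2 ≤ n) (F : (Fin n → X) → X) (d : X) {l : List X}
    (h : l.length < n) : naryReduce n hn F d l = l := by
  rw [naryReduce, if_neg (by omega)]

theorem naryReduce_append {n : ℕ} (hn : 2 ≤ n) (F : (Fin n → X) → X) (d : X) {w : List X}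
    (v : List X) (h : w.length = n) :
    naryReduce n hn F d (w ++ v) = naryReduce n hn F d (naryOnList n F d w :: v) := by
  conv_lhs => rw [naryReduce, if_pos (by simp; omega)]
  congr 2
  · unfold naryOnList
    congr 1
    ext i
    simp [List.getD, List.getElem?_append_left (show (i : ℕ) < w.length by omega)]
  · simp [← h]

theorem NAryAssociative.comp_eq_zero {n : ℕ} {F : (Fin n → X) → X} (hF : NAryAssociative n F)
    (x : ℕ → X) {i : ℕ} (hi : i ≤ n - 1) : naryCompAt n F x i = naryCompAt n F x 0 := by
  induction i with
  | zero => rfl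
  | succ i ih => rw [← hF x i hi, ih (by omega)]

theorem naryCompAt_getD {n : ℕ} (F : (Fin n → X) → X) (d : X) {p w q : List X}
    (hw : w.length = n) :
    naryCompAt n F (fun k => (p ++ w ++ q).getD k d) p.length =
      naryOnList n F d (p ++ naryOnList n F d w :: q) := by
  unfold naryCompAt naryOnList
  congr 1
  ext j
  split_ifs with h₁ h₂
  · simp [List.getD, List.getElem?_append, h₁]
  · have : ∀ k : Fin n, (p ++ w ++ q).getD (p.length + k) d = w.getD k d := by
      intro k
      have := k.2
      simp [List.getD, List.getElem?_append, hw]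
    simp only [this]
    simp [List.getD, h₂]
  · obtain ⟨k, hk⟩ : ∃ k, (j : ℕ) = p.length + (k + 1) := ⟨j - p.length - 1, by omega⟩
    have e : (j : ℕ) + n - 1 = (p ++ w).length + k := by simp [hw]; omega
    rw [e, hk]
    simp only [List.getD]
    rw [List.getElem?_append_right (by omega), List.getElem?_append_right (by omega)]
    simp

theorem NAryAssociative.naryReduce_append_append {n : ℕ} (hn : 2 ≤ n) {F : (Fin n → X) → X}
    (hF : NAryAssociative n F) (d : X) {w v : List X} (hw : w.length = n) :
    ∀ u : List X, n - 1 ∣ u.length + v.length →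
      naryReduce n hn F d (u ++ w ++ v) =
        naryReduce n hn F d (u ++ naryOnList n F d w :: v) := by
  suffices H : ∀ (k : ℕ) (u : List X), u.length = k → n - 1 ∣ u.length + v.length →
      naryReduce n hn F d (u ++ w ++ v) =
        naryReduce n hn F d (u ++ naryOnList n F d w :: v) from fun u => H _ u rfl
  intro k
  induction k using Nat.strong_induction_on with
  | _ k ih =>
  intro u hu hdvd
  by_cases hun : n ≤ u.length
  · obtain ⟨u₁, u₂, rfl, h₁⟩ : ∃ u₁ u₂ : List X, u = u₁ ++ u₂ ∧ u₁.length = n :=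
      ⟨u.take n, u.drop n, by simp, by simp; omega⟩
    simp only [List.length_append, h₁] at hu hdvd
    have := ih (u₂.length + 1) (by omega) (naryOnList n F d u₁ :: u₂) (by simp) (by
      have e : n + u₂.length + v.length = (n - 1) + ((u₂.length + 1) + v.length) := by omega
      rw [e] at hdvd
      simpa using (Nat.dvd_add_right (dvd_refl (n - 1))).1 hdvd)
    simp only [List.append_assoc] at this ⊢
    rw [naryReduce_append hn F d _ h₁, naryReduce_append hn F d _ h₁]
    simpa using this
  · rcases Nat.eq_zero_or_pos u.length with h0 | hpos
    · obtain rfl : u = [] := List.length_eq_zero_iff.1 h0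
      simpa using naryReduce_append hn F d v hw
    · have hle : n - 1 ≤ u.length + v.length := Nat.le_of_dvd (by omega) hdvd
      obtain ⟨v₁, v₂, rfl, h₁⟩ : ∃ v₁ v₂ : List X, v = v₁ ++ v₂ ∧ v₁.length = n - 1 - u.length :=
        ⟨v.take (n - 1 - u.length), v.drop (n - 1 - u.length), by simp, by simp; omega⟩
      obtain ⟨w₁, w₂, rfl, h₂⟩ : ∃ w₁ w₂ : List X, w = w₁ ++ w₂ ∧ w₁.length = n - u.length :=
        ⟨w.take (n - u.length), w.drop (n - u.length), by simp, by simp; omega⟩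
      have A := hF.comp_eq_zero (fun k => (u ++ (w₁ ++ w₂) ++ v₁).getD k d)
        (i := u.length) (by omega)
      have B := naryCompAt_getD F d (p := []) (w := u ++ w₁) (q := w₂ ++ v₁)
        (by simp; omega)
      rw [naryCompAt_getD F d hw] at A
      simp only [List.append_assoc, List.nil_append, List.length_nil] at A B
      rw [B] at A
      have hw' : w₁.length + w₂.length = n := by simpa using hw
      have e₁ : u ++ (w₁ ++ w₂) ++ (v₁ ++ v₂) = (u ++ w₁) ++ (w₂ ++ (v₁ ++ v₂)) := by simp
      have e₂ : u ++ naryOnList n F d (w₁ ++ w₂) :: (v₁ ++ v₂) =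
        (u ++ naryOnList n F d (w₁ ++ w₂) :: v₁) ++ v₂ := by simp
      have e₃ : naryOnList n F d (u ++ w₁) :: (w₂ ++ (v₁ ++ v₂)) =
        (naryOnList n F d (u ++ w₁) :: (w₂ ++ v₁)) ++ v₂ := by simp
      rw [e₁, e₂, naryReduce_append hn F d _ (by simp; omega), e₃,
        naryReduce_append hn F d _ (by simp; omega), naryReduce_append hn F d _ (by simp; omega), A]

/-- Two words are congruent when their lengths agree modulo `n - 1` and they are interchangeable
inside every word whose length is `1` modulo `n - 1`. -/
def naryCon (n : ℕ) (hn : 2 ≤ n) (F : (Fin n → X) → X) (d : X) : Con (FreeMonoid X) where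
  r a b := a.toList.length ≡ b.toList.length [MOD n - 1] ∧
    ∀ u v : List X, u.length + a.toList.length + v.length ≡ 1 [MOD n - 1] →
      naryReduce n hn F d (u ++ a.toList ++ v) = naryReduce n hn F d (u ++ b.toList ++ v)
  iseqv :=
    { refl := fun _ => ⟨rfl, fun _ _ _ => rfl⟩
      symm := fun h => ⟨h.1.symm, fun u v huv =>
        (h.2 u v (((h.1.add_left _).add_right _).trans huv)).symm⟩
      trans := fun h h' => ⟨h.1.trans h'.1, fun u v huv =>
        (h.2 u v huv).trans (h'.2 u v (((h.1.symm.add_left _).add_right _).trans huv))⟩ }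
  mul' := by
    intro a b c e h h'
    refine ⟨by simpa using h.1.add h'.1, fun u v huv => ?_⟩
    simp only [FreeMonoid.toList_mul, List.length_append] at huv ⊢
    have h₁ := h.2 u (c.toList ++ v) (by simpa [add_assoc] using huv)
    have h₂ := h'.2 (u ++ b.toList) v (by
      have := ((h.1.symm.add_left u.length).add_right (c.toList.length + v.length))
      simpa [add_assoc] using this.trans (by simpa [add_assoc] using huv))
    simp only [List.append_assoc] at h₁ h₂ ⊢
    exact h₁.trans h₂

/-- An associative `n`-ary operation is the restriction of the `n`-fold product of a monoid. -/
theorem NAryAssociative.exists_monoid.{u} {X : Type u} [Nonempty X] {n : ℕ} (hn : 2 ≤ n)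
    {F : (Fin n → X) → X} (hF : NAryAssociative n F) :
    ∃ (M : Type u) (_ : Monoid M) (ι : X → M), Function.Injective ι ∧
      ∀ x : Fin n → X, ι (F x) = ((List.ofFn x).map ι).prod := by
  obtain ⟨d⟩ := ‹Nonempty X›
  let c := naryCon n hn F d
  have hprod : ∀ l : List X, (l.map fun a => ((FreeMonoid.of a : FreeMonoid X) : c.Quotient)).prod =
      ((FreeMonoid.ofList l : FreeMonoid X) : c.Quotient) := by
    intro l
    induction l with
    | nil => rfl
    | cons a l ih => rw [List.map_cons, List.prod_cons, ih, FreeMonoid.ofList_cons, Con.coe_mul]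
  refine ⟨c.Quotient, inferInstance, fun a => (FreeMonoid.of a : FreeMonoid X), ?_, ?_⟩
  · intro a b hab
    have := ((Con.eq c).1 hab).2 [] [] (by simp [Nat.ModEq.refl])
    rw [naryReduce_of_length_lt, naryReduce_of_length_lt] at this
    · simpa using this
    all_goals simp; omega
  · intro x
    rw [hprod]
    refine ((Con.eq c).2 ?_).symm
    have hlen : n ≡ 1 [MOD n - 1] := ((Nat.modEq_iff_dvd' (by omega)).2 dvd_rfl).symm
    refine ⟨by simpa using hlen, fun u v huv => ?_⟩
    have hval : naryOnList n F d (List.ofFn x) = F x := by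
      unfold naryOnList
      congr 1
      ext i
      simp [List.getD]
    have h := hF.naryReduce_append_append hn d (w := List.ofFn x) (v := v) (by simp) u (by
      simp only [FreeMonoid.toList_ofList, List.length_ofFn] at huv
      have h₁ : (u.length + v.length) + 1 ≡ 0 + 1 [MOD n - 1] := by
        have h₂ := ((hlen.symm.add_left u.length).add_right v.length).trans huv
        have e : u.length + v.length + 1 = u.length + 1 + v.length := by omega
        rw [e]
        simpa using h₂
      exact (Nat.modEq_zero_iff_dvd).1 (Nat.ModEq.add_right_cancel' 1 h₁))
    rw [hval] at h
    simpa using h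

section Monoid

variable {M : Type*} [Monoid M]

/-- If the `m`-th powers of `x` and `y` cannot be exchanged in `x y`, then that of `y` is also an
identity for `x` on the left. -/
theorem pow_mul_eq_of_pow_mul_eq {m : ℕ} (hm : 2 ≤ m) {x y : M} (hx : x ^ m * x = x)
    (hxy : x ^ m * y = y) (hyx : x * y ^ m = x)
    (h : x ^ (m - 1) * y * x = x ∨ x ^ (m - 1) * y * x = y) : y ^ m * x = x := by
  obtain ⟨k, rfl⟩ : ∃ k, m = k + 1 := ⟨m - 1, by omega⟩
  simp only [Nat.add_sub_cancel] at h
  have key : x * (x ^ k * y * x) = y * x := by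
    rw [← mul_assoc, ← mul_assoc, ← pow_succ', hxy]
  rcases h with h | h
  · rw [h] at key
    have : ∀ j : ℕ, y ^ j * x = x ^ j * x := by
      intro j
      induction j with
      | zero => simp
      | succ j ih => rw [pow_succ, mul_assoc, ← key, ← mul_assoc, ih, pow_succ]
    rw [this, hx]
  · rw [h] at key
    have : Commute x y := key
    rw [← (this.pow_right (k + 1)).eq, hyx]

theorem mul_pow_eq_of_mul_pow_eq {m : ℕ} (hm : 2 ≤ m) {x y : M} (hy : y * y ^ m = y)
    (hxy : x ^ m * y = y) (hyx : x * y ^ m = x)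
    (h : y * x * y ^ (m - 1) = x ∨ y * x * y ^ (m - 1) = y) : y * x ^ m = y := by
  obtain ⟨k, rfl⟩ : ∃ k, m = k + 1 := ⟨m - 1, by omega⟩
  simp only [Nat.add_sub_cancel] at h
  have key : (y * x * y ^ k) * y = y * x := by
    rw [mul_assoc, ← pow_succ, mul_assoc, hyx]
  rcases h with h | h
  · rw [h] at key
    have : Commute x y := key
    rw [← (this.pow_left (k + 1)).eq, hxy]
  · rw [h] at key
    have : ∀ j : ℕ, y * x ^ j = y * y ^ j := by
      intro j
      induction j with
      | zero => simp
      | succ j ih => rw [pow_succ', ← mul_assoc, ← key, mul_assoc, ih, pow_succ']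
    rw [this, hy]

/-- Either the `m`-th powers can be exchanged between neighbours, or some element of `S` is
central with respect to `S` and has an `m`-th power acting as an identity on `S`. -/
theorem exchange_or_exists_central {S : Set M} {m : ℕ} (hm : 2 ≤ m)
    (h : ∀ a ∈ S, ∀ b ∈ S, ∀ i j, i + j = m → b ^ i * a * b ^ j = a ∨ b ^ i * a * b ^ j = b) :
    (∀ x ∈ S, ∀ y ∈ S, x ^ m * y = x * y ^ m) ∨
      ∃ e ∈ S, ∀ a ∈ S, e ^ m * a = a ∧ a * e ^ m = a ∧ Commute e a := by
  have idl : ∀ a ∈ S, a ^ m * a = a := fun a ha => by simpa using h a ha a ha m 0 (by omega)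
  have idr : ∀ a ∈ S, a * a ^ m = a := fun a ha => by simpa using h a ha a ha 0 m (by omega)
  have hl : ∀ a ∈ S, ∀ b ∈ S, b ^ m * a = a ∨ b ^ m * a = b := fun a ha b hb => by
    simpa using h a ha b hb m 0 (by omega)
  have hr : ∀ a ∈ S, ∀ b ∈ S, a * b ^ m = a ∨ a * b ^ m = b := fun a ha b hb => by
    simpa using h a ha b hb 0 m (by omega)
  have hml : ∀ a ∈ S, ∀ b ∈ S, b ^ (m - 1) * a * b = a ∨ b ^ (m - 1) * a * b = b :=
    fun a ha b hb => by simpa using h a ha b hb (m - 1) 1 (by omega)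
  have hmr : ∀ a ∈ S, ∀ b ∈ S, b * a * b ^ (m - 1) = a ∨ b * a * b ^ (m - 1) = b :=
    fun a ha b hb => by simpa using h a ha b hb 1 (m - 1) (by omega)
  by_contra! hcon
  obtain ⟨⟨x, hx, y, hy, hne⟩, hc⟩ := hcon
  obtain ⟨hxy, hyx⟩ : x ^ m * y = y ∧ x * y ^ m = x := by
    have e : x ^ m * y * y ^ m = x ^ m * y := by rw [mul_assoc, idr y hy]
    rcases hl y hy x hx with h₁ | h₁ <;> rcases hr x hx y hy with h₂ | h₂
    · exact ⟨h₁, h₂⟩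
    · exact absurd (h₁.trans h₂.symm) hne
    · exact absurd (h₁.trans h₂.symm) hne
    · rw [h₁] at e
      exact absurd (h₁.trans e.symm) hne
  have hyx' := pow_mul_eq_of_pow_mul_eq hm (idl x hx) hxy hyx (hml y hy x hx).symm
  have hxy' := mul_pow_eq_of_mul_pow_eq hm (idr y hy) hxy hyx (hmr x hx y hy)
  have hxne : x ≠ y := by
    rintro rfl
    exact hne (by rw [hxy, hyx])
  have L : ∀ a ∈ S, x ^ m * a = a := by
    intro a ha
    rcases hl a ha x hx with h₁ | h₁
    · exact h₁
    · have hpow : y ^ m * x ^ m = y ^ m := by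
        obtain ⟨k, rfl⟩ : ∃ k, m = k + 1 := ⟨m - 1, by omega⟩
        rw [pow_succ y, mul_assoc, hxy']
      have h₂ : y ^ m * a = x := by rw [← hpow, mul_assoc, h₁, hyx']
      rcases hl a ha y hy with h₃ | h₃
      · rw [← h₃, h₂, idl x hx]
      · exact absurd (h₂.symm.trans h₃) hxne
  have R : ∀ a ∈ S, a * x ^ m = a := by
    intro a ha
    rcases hr a ha x hx with h₁ | h₁
    · exact h₁
    · have hpow : x ^ m * y ^ m = y ^ m := by
        obtain ⟨k, rfl⟩ : ∃ k, m = k + 1 := ⟨m - 1, by omega⟩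
        rw [pow_succ' y, ← mul_assoc, hxy]
      have h₂ : a * y ^ m = x := by rw [← hpow, ← mul_assoc, h₁, hyx]
      rcases hr a ha y hy with h₃ | h₃
      · rw [← h₃, h₂, idr x hx]
      · exact absurd (h₂.symm.trans h₃) hxne
  refine hc x hx |>.elim fun a ha => ?_
  refine ha.2 (L a ha.1) (R a ha.1) ?_
  have hp : x * x ^ (m - 1) = x ^ m := by
    rw [← pow_succ', Nat.sub_add_cancel (by omega)]
  have key : x * (x ^ (m - 1) * a * x) = a * x := by
    rw [← mul_assoc, ← mul_assoc, hp, L a ha.1]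
  rcases hml a ha.1 x hx with h₁ | h₁
  · rwa [h₁] at key
  · rw [h₁] at key
    have : a = x := by
      have h₂ := R a ha.1
      rw [← hp, ← mul_assoc, ← key, mul_assoc, hp, idr x hx] at h₂
      exact h₂.symm
    rw [this]

theorem pow_mul_iterOp {m : ℕ} (hm : 1 ≤ m) (ι : X → M)
    (hex : ∀ x y, ι x ^ m * ι y = ι x * ι y ^ m) (k : ℕ) (a : X) (x : ℕ → X) :
    ι a ^ m * iterOp (· * ·) k (fun i => ι (x i)) =
      ι a * iterOp (· * ·) k (fun i => ι (x i)) * ι (x k) ^ (m - 1) := by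
  obtain ⟨p, rfl⟩ : ∃ p, m = p + 1 := ⟨m - 1, by omega⟩
  simp only [Nat.add_sub_cancel]
  induction k generalizing a x with
  | zero => simp only [iterOp]; rw [hex, pow_succ', mul_assoc]
  | succ k ih =>
    have := ih (x 0) fun i => x (i + 1)
    simp only [iterOp]
    rw [← mul_assoc, hex, mul_assoc, this]
    simp only [mul_assoc]

theorem iterOp_of_exchange {m : ℕ} (hm : 1 ≤ m) (ι : X → M) (G : X → X → X)
    (hG : ∀ a b, ι (G a b) = ι a ^ m * ι b)
    (hex : ∀ x y, ι x ^ m * ι y = ι x * ι y ^ m) (k : ℕ) (x : ℕ → X) :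
    ι (iterOp G k x) = iterOp (· * ·) k (fun i => ι (x i)) * ι (x k) ^ ((m - 1) * k) := by
  induction k generalizing x with
  | zero => simp [iterOp]
  | succ k ih =>
    simp only [iterOp]
    rw [hG, ih, ← mul_assoc, pow_mul_iterOp hm ι hex k (x 0) fun i => x (i + 1),
      Nat.mul_succ, pow_add, (Commute.pow_pow_self _ _ _).eq]
    simp only [mul_assoc]

theorem iterOp_of_central {p : ℕ} (ι : X → M) (G : X → X → X) (e : M)
    (hG : ∀ a b, ι (G a b) = ι a * e ^ p * ι b)
    (he : ∀ a, Commute e (ι a)) (k : ℕ) (x : ℕ → X) :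
    ι (iterOp G k x) = iterOp (· * ·) k (fun i => ι (x i)) * e ^ (p * k) := by
  have hc : ∀ (k : ℕ) (x : ℕ → X), Commute e (iterOp (· * ·) k fun i => ι (x i)) := by
    intro k
    induction k with
    | zero => exact fun x => he _
    | succ k ih => exact fun x => (he _).mul_right (ih fun i => x (i + 1))
  induction k generalizing x with
  | zero => simp [iterOp]
  | succ k ih =>
    simp only [iterOp]
    rw [hG, ih, mul_assoc, ← mul_assoc (e ^ p), ((hc k fun i => x (i + 1)).pow_left p).eq,
      Nat.mul_succ, Nat.add_comm, pow_add]
    simp only [mul_assoc]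

theorem iterOp_mul_pow_of_last {f : ℕ → M} {b : M} (k : ℕ) (hb : f k * b = f k) :
    iterOp (· * ·) k f * b = iterOp (· * ·) k f := by
  induction k generalizing f with
  | zero => exact hb
  | succ k ih => simp only [iterOp]; rw [mul_assoc, ih hb]

theorem prod_ofFn_eq_iterOp (k : ℕ) (f : ℕ → M) :
    (List.ofFn fun i : Fin (k + 1) => f i).prod = iterOp (· * ·) k f := by
  induction k generalizing f with
  | zero => simp [iterOp]
  | succ k ih =>
    rw [List.ofFn_succ, List.prod_cons, iterOp, ← ih]
    simp

theorem mul_pow_eq_self {a b : M} (h : a * b = a) (k : ℕ) : a * b ^ k = a := by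
  induction k with
  | zero => simp
  | succ k ih => rw [pow_succ', ← mul_assoc, h, ih]

end Monoid

theorem List.ofFn_update_const {n i j : ℕ} (hij : i + j + 1 = n) (a b : X) :
    List.ofFn (Function.update (fun _ : Fin n => b) ⟨i, by omega⟩ a) =
      List.replicate i b ++ [a] ++ List.replicate j b := by
  apply List.ext_getElem
  · simp; omega
  · intro k h₁ h₂
    simp only [List.getElem_ofFn, Function.update_apply, Fin.mk.injEq, List.getElem_append,
      List.getElem_replicate, List.length_append, List.length_replicate, List.length_singleton]
    split_ifs <;> first | rfl | omega | simp

/-- Every associative operation quasitrivial on `D^n_{n-1}` is reducible to an associative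
binary operation. -/
theorem stmt_14 {X : Type*} [Nonempty X] (n : ℕ) (hn : 3 ≤ n)
    (F : (Fin n → X) → X) (hF : NAryAssociative n F)
    (hQ : NAryQuasitrivialOnD n (n - 1) F) :
    ∃ G : X → X → X, (∀ a b c, G (G a b) c = G a (G b c)) ∧ NAryReducibleTo n F G := by
  obtain ⟨M, _, ι, hι, hFι⟩ := hF.exists_monoid (by omega)
  obtain ⟨m, rfl⟩ : ∃ m, n = m + 1 := ⟨n - 1, by omega⟩
  have hm : 2 ≤ m := by omega
  have hFι' : ∀ x : ℕ → X, ι (F fun i => x i) = iterOp (· * ·) m fun i => ι (x i) := by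
    intro x
    rw [hFι, List.map_ofFn, ← prod_ofFn_eq_iterOp]
    rfl
  have hpow : ∀ (a b : X) (i j : ℕ) (hij : i + j = m),
      ι (F (Function.update (fun _ => b) ⟨i, by omega⟩ a)) = ι b ^ i * ι a * ι b ^ j := by
    intro a b i j hij
    rw [hFι, List.ofFn_update_const (j := j) (by omega)]
    simp [mul_assoc]
  have hS : ∀ a ∈ Set.range ι, ∀ b ∈ Set.range ι, ∀ i j, i + j = m →
      b ^ i * a * b ^ j = a ∨ b ^ i * a * b ^ j = b := by
    rintro _ ⟨a, rfl⟩ _ ⟨b, rfl⟩ i j hij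
    rw [← hpow a b i j hij]
    have hi : i < m + 1 := by omega
    obtain ⟨k, hk⟩ := hQ (Function.update (fun _ => b) ⟨i, hi⟩ a)
      ⟨Finset.univ.erase ⟨i, hi⟩, by simp, fun p hp q hq => by
        rw [Function.update_of_ne (Finset.ne_of_mem_erase hp),
          Function.update_of_ne (Finset.ne_of_mem_erase hq)]⟩
    rw [← hk, Function.update_apply]
    split_ifs
    · exact Or.inl rfl
    · exact Or.inr rfl
  have hid : ∀ a, ι a * ι a ^ m = ι a := fun a => by
    simpa using hS _ ⟨a, rfl⟩ _ ⟨a, rfl⟩ 0 m (by omega)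
  rcases exchange_or_exists_central hm hS with hex | ⟨_, ⟨e, rfl⟩, he⟩
  · have hex' : ∀ x y, ι x ^ m * ι y = ι x * ι y ^ m := fun x y => hex _ ⟨x, rfl⟩ _ ⟨y, rfl⟩
    have hG : ∀ a b, ∃ c, ι c = ι a ^ m * ι b := fun a b =>
      ⟨_, by simpa using hpow b a m 0 (by omega)⟩
    choose G hG using hG
    refine ⟨G, fun a b c => hι ?_, fun x => hι ?_⟩
    · rw [hG, hex', hG, hG, hG, hex' b c, mul_assoc]
    · rw [hFι', Nat.add_sub_cancel, iterOp_of_exchange (by omega) ι G hG hex', mul_comm (m - 1),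
        pow_mul]
      exact (iterOp_mul_pow_of_last m (mul_pow_eq_self (hid _) _)).symm
  · have hG : ∀ a b, ∃ c, ι c = ι a * ι e ^ (m - 1) * ι b := fun a b => by
      refine ⟨F fun i : Fin (m + 1) => (a :: (List.replicate (m - 1) e ++ [b])).getD i e, ?_⟩
      rw [hFι]
      have : (List.ofFn fun i : Fin (m + 1) =>
          (a :: (List.replicate (m - 1) e ++ [b])).getD i e) =
          a :: (List.replicate (m - 1) e ++ [b]) := by
        apply List.ext_getElem
        · simp; omega
        · intro k h₁ h₂
          simp only [List.getElem_ofFn]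
          rw [List.getD_eq_getElem _ _ h₂]
      rw [this]
      simp [mul_assoc]
    choose G hG using hG
    refine ⟨G, fun a b c => hι ?_, fun x => hι ?_⟩
    · simp only [hG, mul_assoc]
    · rw [hFι', Nat.add_sub_cancel,
        iterOp_of_central ι G (ι e) hG (fun a => (he _ ⟨a, rfl⟩).2.2), mul_comm (m - 1), pow_mul]
      exact (iterOp_mul_pow_of_last m (mul_pow_eq_self (he _ ⟨_, rfl⟩).2.1 _)).symm
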